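/- Let V be a vertex algebra with two-variable multiplication X_{z1,z2}(a⊗b) := e^{z2 D} Y(a, z1−z2) b ∈ V[[z1,z2]][(z1−z2)^{-1}], where Y satisfies the vertex algebra axioms. Then X is symmetric: X_{z1,z2}(a⊗b) = X_{z2,z1}(b⊗a) for all a,b ∈ V. -/

import Mathlib

/- Vertex algebra setup (coefficient formulation).
V is a ℂ-vector space with translation operator D and vacuum `vac`; the vertex
operators are given by their coefficients: `Y a b n` = coefficient of z^n in Y(a,z)b.
Axioms used as hypotheses:
 * field/truncation: `Y a b n = 0` for `n < -(Nf a b)`;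
 * vacuum: `Y(1,z) = id` and `Y(a,z)1 = e^{zD}a` (coefficients `expCoeff D a n`);
 * translation covariance: `[D,Y(a,z)] = ∂_z Y(a,z)`, coefficientwise
   `D (Y a b n) − Y a (D b) n = (n+1) • Y a b (n+1)`;
 * weak commutativity: for all a,b there is N with (z1−z2)^N [Y(a,z1),Y(b,z2)] = 0,
   stated coefficientwise using the binomial expansion of (z1−z2)^N.

X_{z1,z2}(a⊗b) := e^{z2 D} Y(a, z1−z2) b ∈ V[[z1,z2]][(z1−z2)^{-1}].  Elements of
that ring are faithfully represented by their expansions into formal distributions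
(the expansion maps are injective), so identities in it are stated as identities of
expansion coefficients.
 * `X1coeff D Y a b m n` = coefficient of z1^m z2^n of i_{z1;z2} X_{z1,z2}(a⊗b),
   expanding (z1−z2)^k (k ∈ ℤ) in the region |z1|>|z2| via generalized binomial
   coefficients `intChoose`;
 * `X2coeff D Y a b m n` = coefficient of z1^m z2^n of i_{z2;z1} X_{z1,z2}(a⊗b),
   expanding (z1−z2)^k in |z2|>|z1| (the j-sum over powers of D is finite by the
   truncation axiom; we use `finsum`). -/

noncomputable section
open Finset

noncomputable def expCoeff {V : Type*} [AddCommGroup V] [Module ℂ V]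
    (D : Module.End ℂ V) (a : V) (n : ℤ) : V :=
  if 0 ≤ n then ((n.toNat.factorial : ℂ))⁻¹ • (D ^ n.toNat) a else 0

/-- generalized binomial coefficient `k(k-1)⋯(k-l+1)/l!` for `k : ℤ` -/
noncomputable def intChoose (k : ℤ) (l : ℕ) : ℂ :=
  ((l.factorial : ℂ))⁻¹ * ∏ i ∈ Finset.range l, ((k : ℂ) - (i : ℂ))

/-- coefficient of z1^m z2^n in the |z1|>|z2| expansion of e^{z2 D} Y(a,z1−z2) b -/
noncomputable def X1coeff {V : Type*} [AddCommGroup V] [Module ℂ V]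
    (D : Module.End ℂ V) (Y : V → V → ℤ → V) (a b : V) (m n : ℤ) : V :=
  if 0 ≤ n then
    ∑ j ∈ Finset.range (n.toNat + 1),
      (((j.factorial : ℂ))⁻¹ * (-1 : ℂ) ^ (n.toNat - j) *
        intChoose (m + ((n.toNat - j : ℕ) : ℤ)) (n.toNat - j)) •
        (D ^ j) (Y a b (m + ((n.toNat - j : ℕ) : ℤ)))
  else 0

/-- coefficient of z1^m z2^n in the |z2|>|z1| expansion of e^{z2 D} Y(a,z1−z2) b -/
noncomputable def X2coeff {V : Type*} [AddCommGroup V] [Module ℂ V]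
    (D : Module.End ℂ V) (Y : V → V → ℤ → V) (a b : V) (m n : ℤ) : V :=
  if 0 ≤ m then
    ∑ᶠ j : ℕ,
      (((j.factorial : ℂ))⁻¹ * (-1 : ℂ) ^ (m + n - (j : ℤ)) * (-1 : ℂ) ^ m.toNat *
        intChoose (m + n - (j : ℤ)) m.toNat) •
        (D ^ j) (Y a b (m + n - (j : ℤ)))
  else 0


section Helpers
variable {V : Type*} [AddCommGroup V] [Module ℂ V]

/-- multiplication by the first variable -/
def sh1 : Module.End ℂ (ℤ → ℤ → V) where
  toFun P := fun m n => P (m - 1) n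
  map_add' _ _ := rfl
  map_smul' _ _ := rfl

/-- multiplication by the second variable -/
def sh2 : Module.End ℂ (ℤ → ℤ → V) where
  toFun P := fun m n => P m (n - 1)
  map_add' _ _ := rfl
  map_smul' _ _ := rfl

/-- multiplication by the difference of the variables -/
def del : Module.End ℂ (ℤ → ℤ → V) := -sh2 + sh1

lemma del_apply (P : ℤ → ℤ → V) (m n : ℤ) : del P m n = P (m - 1) n - P m (n - 1) := by
  change -(P m (n-1)) + P (m-1) n = _
  abel

lemma del_pow_succ (N : ℕ) (P : ℤ → ℤ → V) : (del ^ (N + 1)) P = (del ^ N) (del P) := by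
  rw [pow_succ]; rfl

lemma sh1_pow (k : ℕ) (P : ℤ → ℤ → V) (m n : ℤ) : (sh1 ^ k) P m n = P (m - k) n := by
  induction k generalizing P with
  | zero => simp
  | succ k ih =>
    rw [pow_succ, Module.End.mul_apply, ih]
    change P (m - k - 1) n = _
    push_cast; congr 1; ring

lemma nsh2_pow (k : ℕ) (P : ℤ → ℤ → V) (m n : ℤ) :
    ((-sh2) ^ k) P m n = ((-1 : ℂ) ^ k) • P m (n - k) := by
  induction k generalizing P with
  | zero => simp
  | succ k ih =>
    rw [pow_succ, Module.End.mul_apply, ih]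
    change _ • -(P m (n - k - 1)) = _
    have : n - ((k + 1 : ℕ) : ℤ) = n - k - 1 := by push_cast; ring
    rw [this, pow_succ]; simp

lemma del_pow_apply (N : ℕ) (P : ℤ → ℤ → V) (m n : ℤ) :
    (del ^ N) P m n = ∑ l ∈ Finset.range (N + 1), ((-1 : ℂ) ^ l * (N.choose l : ℂ)) •
      P (m - ((N - l : ℕ) : ℤ)) (n - (l : ℤ)) := by
  have hc : Commute (-sh2 : Module.End ℂ (ℤ → ℤ → V)) sh1 := by
    apply LinearMap.ext; intro P; rfl
  rw [del, hc.add_pow, LinearMap.sum_apply, Finset.sum_apply, Finset.sum_apply]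
  refine Finset.sum_congr rfl fun l _ => ?_
  have h : ((-sh2 : Module.End ℂ (ℤ → ℤ → V)) ^ l * sh1 ^ (N - l) * ((N.choose l : ℕ) : Module.End ℂ (ℤ → ℤ → V)) : Module.End ℂ (ℤ → ℤ → V)) P
      = (N.choose l : ℂ) • ((-sh2) ^ l) ((sh1 ^ (N - l)) P) := by
    rw [Module.End.mul_apply, Module.End.mul_apply, Module.End.natCast_apply, map_nsmul, map_nsmul,
      Nat.cast_smul_eq_nsmul]
  rw [h, Pi.smul_apply, Pi.smul_apply, nsh2_pow, sh1_pow, smul_smul, mul_comm]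

lemma del_pow_mono {N M : ℕ} (h : N ≤ M) {P : ℤ → ℤ → V} (hP : (del ^ N) P = 0) :
    (del ^ M) P = 0 := by
  obtain ⟨k, rfl⟩ := Nat.exists_eq_add_of_le h
  rw [add_comm, pow_add, Module.End.mul_apply, hP, map_zero]

lemma kill_one_left (P : ℤ → ℤ → V) (hs : ∀ m n, m < 0 → P m n = 0) (h : del P = 0) : P = 0 := by
  have key : ∀ (k : ℕ) (n : ℤ), P ((k : ℤ) - 1) n = 0 := by
    intro k
    induction k with
    | zero => intro n; exact hs _ _ (by simp)
    | succ k ih =>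
      intro n
      have := congrFun (congrFun h (k : ℤ)) (n + 1)
      rw [del_apply, ih] at this
      simpa using this
  funext m n
  by_cases hm : m < 0
  · exact hs _ _ hm
  · have := key (m + 1).toNat n
    rwa [Int.toNat_of_nonneg (by omega), add_sub_cancel_right] at this

lemma kill_one_right (P : ℤ → ℤ → V) (hs : ∀ m n, n < 0 → P m n = 0) (h : del P = 0) : P = 0 := by
  have key : ∀ (k : ℕ) (m : ℤ), P m ((k : ℤ) - 1) = 0 := by
    intro k
    induction k with
    | zero => intro n; exact hs _ _ (by simp)
    | succ k ih =>
      intro m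
      have := congrFun (congrFun h (m + 1)) (k : ℤ)
      rw [del_apply, ih] at this
      simpa using this
  funext m n
  by_cases hm : n < 0
  · exact hs _ _ hm
  · have := key (n + 1).toNat m
    rwa [Int.toNat_of_nonneg (by omega), add_sub_cancel_right] at this

lemma kill_left (N : ℕ) (P : ℤ → ℤ → V) (hs : ∀ m n, m < 0 → P m n = 0)
    (h : (del ^ N) P = 0) : P = 0 := by
  induction N generalizing P with
  | zero => simpa using h
  | succ N ih =>
    rw [del_pow_succ] at h
    refine kill_one_left P hs (ih _ ?_ h)
    intro m n hm
    rw [del_apply, hs _ _ (by omega), hs _ _ hm, sub_zero]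

lemma kill_right (N : ℕ) (P : ℤ → ℤ → V) (hs : ∀ m n, n < 0 → P m n = 0)
    (h : (del ^ N) P = 0) : P = 0 := by
  induction N generalizing P with
  | zero => simpa using h
  | succ N ih =>
    rw [del_pow_succ] at h
    refine kill_one_right P hs (ih _ ?_ h)
    intro m n hm
    rw [del_apply, hs _ _ hm, hs _ _ (by omega), sub_zero]

/-- `D - ∂₁` -/
def dd (D : Module.End ℂ V) (P : ℤ → ℤ → V) : ℤ → ℤ → V :=
  fun m n => D (P m n) - (m + 1) • P (m + 1) n

lemma dd_del (D : Module.End ℂ V) (P : ℤ → ℤ → V) : del (dd D P) = dd D (del P) + P := by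
  funext m n
  simp only [del_apply, dd, Pi.add_apply, map_sub, sub_add_cancel, add_sub_cancel_right]
  module

lemma dd_kill (D : Module.End ℂ V) (N : ℕ) (P : ℤ → ℤ → V) (h : (del ^ N) P = 0) :
    (del ^ (N + 1)) (dd D P) = 0 := by
  induction N generalizing P with
  | zero =>
    have : P = 0 := by simpa using h
    subst this
    have : dd D (0 : ℤ → ℤ → V) = 0 := by funext m n; simp [dd]
    rw [this, map_zero]
  | succ N ih =>
    rw [del_pow_succ, dd_del, map_add, h, add_zero]
    apply ih
    rwa [← del_pow_succ]

lemma del_pow_congr (N : ℕ) (P Q : ℤ → ℤ → V) (d : ℤ) (h : ∀ m n, m + n = d → P m n = Q m n)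
    (m n : ℤ) (hmn : m + n = d + N) : (del ^ N) P m n = (del ^ N) Q m n := by
  rw [del_pow_apply, del_pow_apply]
  refine Finset.sum_congr rfl fun l hl => ?_
  rw [h]
  have := Finset.mem_range.mp hl
  omega

/- Binomial expansions -/
lemma intChoose_zero (k : ℤ) : intChoose k 0 = 1 := by simp [intChoose]

lemma intChoose_zero_succ (l : ℕ) : intChoose 0 (l + 1) = 0 := by
  simp [intChoose, Finset.prod_range_succ']

lemma prod_shift (k : ℤ) (s : ℕ) : ∏ i ∈ Finset.range (s + 1), (((k + 1 : ℤ) : ℂ) - (i : ℂ)) =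
    ((k : ℂ) + 1) * ∏ i ∈ Finset.range s, ((k : ℂ) - (i : ℂ)) := by
  rw [Finset.prod_range_succ', mul_comm]
  congr 1
  · push_cast; ring
  · refine Finset.prod_congr rfl fun i _ => ?_
    push_cast; ring

lemma intChoose_pascal (k : ℤ) (s : ℕ) :
    intChoose (k + 1) (s + 1) = intChoose k (s + 1) + intChoose k s := by
  unfold intChoose
  rw [prod_shift, Finset.prod_range_succ, Nat.factorial_succ]
  have h1 : (s.factorial : ℂ) ≠ 0 := by exact_mod_cast s.factorial_ne_zero
  have h2 : (s : ℂ) + 1 ≠ 0 := by exact_mod_cast s.succ_ne_zero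
  push_cast
  field_simp
  ring

lemma intChoose_absorb (m : ℤ) (i : ℕ) :
    ((i : ℂ) + 1) * intChoose (m + (i + 1 : ℕ)) (i + 1) =
      ((m : ℂ) + 1) * intChoose (m + 1 + i) i := by
  unfold intChoose
  rw [Finset.prod_range_succ, Nat.factorial_succ]
  have h1 : (i.factorial : ℂ) ≠ 0 := by exact_mod_cast i.factorial_ne_zero
  have h2 : (i : ℂ) + 1 ≠ 0 := by exact_mod_cast i.succ_ne_zero
  have h3 : m + ((i + 1 : ℕ) : ℤ) = m + 1 + i := by push_cast; ring
  rw [h3]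
  push_cast
  field_simp
  ring

def expA (k s t : ℤ) : ℂ :=
  if 0 ≤ s ∧ s + t = k then (-1) ^ s.toNat * intChoose k s.toNat else 0

def expB (k s t : ℤ) : ℂ :=
  if 0 ≤ t ∧ s + t = k then (-1) ^ k * (-1) ^ t.toNat * intChoose k t.toNat else 0

lemma expA_rec (k s t : ℤ) : expA (k + 1) s t = expA k s (t - 1) - expA k (s - 1) t := by
  unfold expA
  by_cases h : s + t = k + 1
  · have h1 : s + (t - 1) = k := by omega
    have h2 : s - 1 + t = k := by omega
    simp only [h, h1, h2, and_true]
    rcases lt_trichotomy s 0 with hs | hs | hs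
    · rw [if_neg (by omega), if_neg (by omega), if_neg (by omega)]; simp
    · subst hs; simp [intChoose_zero]
    · obtain ⟨u, rfl⟩ : ∃ u : ℕ, s = (u : ℤ) + 1 := ⟨(s - 1).toNat, by omega⟩
      have e1 : ((u : ℤ) + 1).toNat = u + 1 := by omega
      have e2 : ((u : ℤ) + 1 - 1).toNat = u := by omega
      rw [if_pos (by omega), if_pos (by omega), if_pos (by omega), e1, e2, intChoose_pascal]
      ring
  · rw [if_neg (by omega), if_neg (by omega), if_neg (by omega)]; simp

lemma expB_rec (k s t : ℤ) : expB (k + 1) s t = expB k s (t - 1) - expB k (s - 1) t := by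
  unfold expB
  have hz : (-1 : ℂ) ^ (k + 1) = -(-1) ^ k := by
    rw [zpow_add₀ (by norm_num)]; simp
  by_cases h : s + t = k + 1
  · have h1 : s + (t - 1) = k := by omega
    have h2 : s - 1 + t = k := by omega
    simp only [h, h1, h2, and_true]
    rcases lt_trichotomy t 0 with hs | hs | hs
    · rw [if_neg (by omega), if_neg (by omega), if_neg (by omega)]; simp
    · subst hs; simp [intChoose_zero, hz]
    · obtain ⟨u, rfl⟩ : ∃ u : ℕ, t = (u : ℤ) + 1 := ⟨(t - 1).toNat, by omega⟩
      have e1 : ((u : ℤ) + 1).toNat = u + 1 := by omega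
      have e2 : ((u : ℤ) + 1 - 1).toNat = u := by omega
      rw [if_pos (by omega), if_pos (by omega), if_pos (by omega), e1, e2, intChoose_pascal, hz]
      ring
  · rw [if_neg (by omega), if_neg (by omega), if_neg (by omega)]; simp

lemma expAB (k : ℕ) (s t : ℤ) : expA k s t = expB k s t := by
  induction k generalizing s t with
  | zero =>
    unfold expA expB
    by_cases h : s + t = 0
    · rcases lt_trichotomy s 0 with hs | hs | hs
      · obtain ⟨u, hu⟩ : ∃ u : ℕ, t.toNat = u + 1 := ⟨t.toNat - 1, by omega⟩
        rw [if_neg (by omega), if_pos (by simp; omega), hu]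
        simp [intChoose_zero_succ]
      · have : t = 0 := by omega
        subst hs; subst this; simp
      · obtain ⟨u, hu⟩ : ∃ u : ℕ, s.toNat = u + 1 := ⟨s.toNat - 1, by omega⟩
        rw [if_pos (by simp; omega), if_neg (by omega), hu]
        simp [intChoose_zero_succ]
    · rw [if_neg (by simp; omega), if_neg (by simp; omega)]
  | succ k ih =>
    push_cast
    rw [expA_rec, expB_rec, ih, ih]

def pt (j : ℕ) (k : ℤ) (v : V) : ℤ → ℤ → V :=
  fun m n => (expA k (m - j) n - expB k (m - j) n) • v

lemma del_pt (j : ℕ) (k : ℤ) (v : V) : del (pt j k v) = pt j (k + 1) (-v) := by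
  funext m n
  rw [del_apply]
  simp only [pt]
  rw [expA_rec, expB_rec, show m - 1 - (j : ℤ) = m - j - 1 by ring]
  module

lemma del_pow_pt (M j : ℕ) (k : ℤ) (v : V) (h : 0 ≤ k + M) : (del ^ M) (pt j k v) = 0 := by
  induction M generalizing k v with
  | zero =>
    obtain ⟨u, rfl⟩ := Int.eq_ofNat_of_zero_le (show 0 ≤ k by simpa using h)
    funext m n
    simp [pt, expAB]
  | succ M ih =>
    rw [del_pow_succ, del_pt]
    apply ih
    push_cast at h
    omega

/- X1coeff -/
lemma X1_nat (D : Module.End ℂ V) (Y : V → V → ℤ → V) (a b : V) (m : ℤ) (n : ℕ) :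
    X1coeff D Y a b m n = ∑ p ∈ Finset.HasAntidiagonal.antidiagonal n,
      (((p.1.factorial : ℂ))⁻¹ * (-1 : ℂ) ^ p.2 * intChoose (m + (p.2 : ℤ)) p.2) •
        (D ^ p.1) (Y a b (m + (p.2 : ℤ))) := by
  rw [Finset.Nat.sum_antidiagonal_eq_sum_range_succ_mk]
  simp [X1coeff]

lemma X1_rec (D : Module.End ℂ V) (Y : V → V → ℤ → V) (a b : V) (m : ℤ) (n : ℕ) :
    ((n : ℂ) + 1) • X1coeff D Y a b m ((n + 1 : ℕ) : ℤ) =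
      D (X1coeff D Y a b m n) - (m + 1) • X1coeff D Y a b (m + 1) n := by
  have hm : ∀ v : V, (m + 1) • v = ((m : ℂ) + 1) • v := by
    intro v; rw [← Int.cast_smul_eq_zsmul ℂ]; push_cast; rfl
  rw [hm, X1_nat, X1_nat, X1_nat]
  set F : ℕ × ℕ → V := fun p => (((p.1.factorial : ℂ))⁻¹ * (-1 : ℂ) ^ p.2 *
    intChoose (m + (p.2 : ℤ)) p.2) • (D ^ p.1) (Y a b (m + (p.2 : ℤ))) with hF
  have split : ((n : ℂ) + 1) • ∑ p ∈ Finset.HasAntidiagonal.antidiagonal (n + 1), F p =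
      ∑ p ∈ Finset.HasAntidiagonal.antidiagonal (n + 1), (p.1 : ℂ) • F p +
      ∑ p ∈ Finset.HasAntidiagonal.antidiagonal (n + 1), (p.2 : ℂ) • F p := by
    rw [← Finset.sum_add_distrib, Finset.smul_sum]
    refine Finset.sum_congr rfl fun p hp => ?_
    rw [← add_smul]
    congr 1
    have := Finset.HasAntidiagonal.mem_antidiagonal.mp hp
    exact_mod_cast this.symm
  rw [split, Finset.Nat.sum_antidiagonal_succ, Finset.Nat.sum_antidiagonal_succ' (f := fun p => (p.2 : ℂ) • F p)]
  simp only [Nat.cast_zero, zero_smul, zero_add, add_zero]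
  rw [map_sum, sub_eq_add_neg, Finset.smul_sum, ← Finset.sum_neg_distrib]
  congr 1
  · refine Finset.sum_congr rfl fun p _ => ?_
    simp only [hF, map_smul, smul_smul]
    rw [pow_succ' D, Module.End.mul_apply]
    congr 1
    rw [Nat.factorial_succ]
    have h1 : (p.1.factorial : ℂ) ≠ 0 := by exact_mod_cast p.1.factorial_ne_zero
    have h2 : (p.1 : ℂ) + 1 ≠ 0 := by exact_mod_cast p.1.succ_ne_zero
    push_cast
    field_simp
  · refine Finset.sum_congr rfl fun p _ => ?_
    simp only [hF, smul_smul]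
    rw [← neg_smul]
    have h3 : m + ((p.2 + 1 : ℕ) : ℤ) = m + 1 + p.2 := by push_cast; ring
    have h4 := intChoose_absorb m p.2
    rw [h3] at h4 ⊢
    congr 1
    push_cast
    rw [pow_succ]
    linear_combination (-(((p.1.factorial : ℂ))⁻¹ * (-1 : ℂ) ^ p.2)) * h4

lemma X1_expA (D : Module.End ℂ V) (Y : V → V → ℤ → V) (a b : V) (M : ℕ)
    (hf : ∀ n : ℤ, n < -(M : ℤ) → Y b a n = 0) (d m n : ℤ) (h : m + n = d) :
    X1coeff D Y b a n m = ∑ j ∈ Finset.range (d + M + 1).toNat,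
      expA (d - j) (m - j) n • ((j.factorial : ℂ)⁻¹ • (D ^ j) (Y b a (d - j))) := by
  have hA : ∀ j : ℕ, m < j → expA (d - j) (m - j) n = 0 := by
    intro j hj; unfold expA; rw [if_neg (by omega)]
  by_cases hm : 0 ≤ m
  · unfold X1coeff
    rw [if_pos hm]
    set R := max (m.toNat + 1) (d + M + 1).toNat with hR
    have e1 : ∑ j ∈ Finset.range (d + M + 1).toNat,
        expA (d - j) (m - j) n • ((j.factorial : ℂ)⁻¹ • (D ^ j) (Y b a (d - j))) =
        ∑ j ∈ Finset.range R,
        expA (d - j) (m - j) n • ((j.factorial : ℂ)⁻¹ • (D ^ j) (Y b a (d - j))) := by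
      apply Finset.sum_subset
      · intro j hj; simp only [Finset.mem_range] at hj ⊢; omega
      · intro j _ hj
        simp only [Finset.mem_range] at hj
        rw [hf _ (by omega)]; simp
    have e2 : ∑ j ∈ Finset.range (m.toNat + 1),
        expA (d - j) (m - j) n • ((j.factorial : ℂ)⁻¹ • (D ^ j) (Y b a (d - j))) =
        ∑ j ∈ Finset.range R,
        expA (d - j) (m - j) n • ((j.factorial : ℂ)⁻¹ • (D ^ j) (Y b a (d - j))) := by
      apply Finset.sum_subset
      · intro j hj; simp only [Finset.mem_range] at hj ⊢; omega
      · intro j _ hj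
        simp only [Finset.mem_range] at hj
        rw [hA _ (by omega)]; simp
    rw [e1, ← e2]
    refine Finset.sum_congr rfl fun j hj => ?_
    have hj := Finset.mem_range.mp hj
    have e3 : n + ((m.toNat - j : ℕ) : ℤ) = d - j := by omega
    have e4 : (m - j).toNat = m.toNat - j := by omega
    unfold expA
    rw [e3, if_pos (by omega), e4, smul_smul]
    congr 1
    ring
  · unfold X1coeff
    rw [if_neg hm]
    symm
    refine Finset.sum_eq_zero fun j _ => ?_
    rw [hA _ (by omega), zero_smul]

lemma X2_expB (D : Module.End ℂ V) (Y : V → V → ℤ → V) (a b : V) (M : ℕ)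
    (hf : ∀ n : ℤ, n < -(M : ℤ) → Y b a n = 0) (d m n : ℤ) (h : m + n = d) :
    X2coeff D Y b a n m = ∑ j ∈ Finset.range (d + M + 1).toNat,
      expB (d - j) (m - j) n • ((j.factorial : ℂ)⁻¹ • (D ^ j) (Y b a (d - j))) := by
  have h' : n + m = d := by omega
  unfold X2coeff
  by_cases hn : 0 ≤ n
  · rw [if_pos hn, finsum_eq_sum_of_support_subset (s := Finset.range (d + M + 1).toNat)]
    · refine Finset.sum_congr rfl fun j _ => ?_
      unfold expB
      rw [if_pos (by omega), h', smul_smul]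
      congr 1
      ring
    · intro j hj
      by_contra hc
      apply hj
      simp only [Finset.coe_range, Set.mem_Iio] at hc
      beta_reduce
      rw [hf _ (by omega)]; simp
  · rw [if_neg hn]
    symm
    refine Finset.sum_eq_zero fun j _ => ?_
    unfold expB
    rw [if_neg (by omega), zero_smul]

lemma X1_X2_kill (D : Module.End ℂ V) (Y : V → V → ℤ → V) (a b : V) (M : ℕ)
    (hf : ∀ n : ℤ, n < -(M : ℤ) → Y b a n = 0) :
    (del ^ M) (fun m n => X1coeff D Y b a n m - X2coeff D Y b a n m) = 0 := by
  funext m n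
  set d := m + n - M with hd
  rw [del_pow_congr M _ (∑ j ∈ Finset.range (d + M + 1).toNat,
    pt j (d - j) ((j.factorial : ℂ)⁻¹ • (D ^ j) (Y b a (d - j)))) d _ m n (by omega)]
  · rw [map_sum, Finset.sum_eq_zero]
    intro j _
    by_cases hj : 0 ≤ d - j + M
    · exact del_pow_pt _ _ _ _ hj
    · rw [hf _ (by omega)]
      have : pt j (d - j) ((j.factorial : ℂ)⁻¹ • (D ^ j) (0 : V)) = 0 := by
        funext m n; simp [pt]
      rw [this, map_zero]
  · intro m' n' h
    rw [X1_expA D Y a b M hf d m' n' h, X2_expB D Y a b M hf d m' n' h, ← Finset.sum_sub_distrib,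
      Finset.sum_apply, Finset.sum_apply]
    refine Finset.sum_congr rfl fun j _ => ?_
    simp only [pt, sub_smul]

lemma expCoeff_neg (D : Module.End ℂ V) (a : V) (n : ℤ) (h : n < 0) : expCoeff D a n = 0 := by
  unfold expCoeff; rw [if_neg (by omega)]

lemma expCoeff_zero (D : Module.End ℂ V) (a : V) : expCoeff D a 0 = a := by
  simp [expCoeff]

lemma expCoeff_D (D : Module.End ℂ V) (a : V) (n : ℤ) :
    expCoeff D (D a) n = D (expCoeff D a n) := by
  unfold expCoeff
  split_ifs
  · rw [map_smul, ← Module.End.mul_apply, ← Module.End.mul_apply, ← pow_succ, ← pow_succ']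
  · simp

lemma D_expCoeff (D : Module.End ℂ V) (a : V) (n : ℤ) :
    D (expCoeff D a n) = (n + 1) • expCoeff D a (n + 1) := by
  unfold expCoeff
  rcases lt_trichotomy n (-1) with h | h | h
  · rw [if_neg (by omega), if_neg (by omega)]; simp
  · subst h; simp
  · obtain ⟨k, rfl⟩ := Int.eq_ofNat_of_zero_le (show 0 ≤ n by omega)
    have e : ((k : ℤ) + 1).toNat = k + 1 := by omega
    rw [if_pos (by omega), if_pos (by omega), e, ← Int.cast_smul_eq_zsmul ℂ, smul_smul, map_smul,
      ← Module.End.mul_apply, ← pow_succ', Int.toNat_natCast]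
    congr 1
    rw [Nat.factorial_succ]
    have h1 : (k.factorial : ℂ) ≠ 0 := by exact_mod_cast k.factorial_ne_zero
    have h2 : (k : ℂ) + 1 ≠ 0 := by exact_mod_cast k.succ_ne_zero
    push_cast
    field_simp

end Helpers

/- STATEMENT 6: symmetry of the two-variable multiplication:
X_{z1,z2}(a⊗b) = X_{z2,z1}(b⊗a) in V[[z1,z2]][(z1−z2)^{-1}].  Comparing the
i_{z1;z2}-expansions of both sides (the expansion is injective on this ring): the
i_{z1;z2}-expansion of X_{z2,z1}(b⊗a) = e^{z1 D} Y(b, z2−z1) a has coefficient of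
z1^m z2^n equal to `X2coeff D Y b a n m` (swap the roles of the variables). -/
theorem stmt6
    {V : Type*} [AddCommGroup V] [Module ℂ V]
    (D : Module.End ℂ V) (vac : V) (Y : V → V → ℤ → V)
    (Nf : V → V → ℕ)
    (hfield : ∀ (a b : V) (n : ℤ), n < -(Nf a b : ℤ) → Y a b n = 0)
    (hvacLeft : ∀ (b : V) (n : ℤ), Y vac b n = if n = 0 then b else 0)
    (hvacRight : ∀ (a : V) (n : ℤ), Y a vac n = expCoeff D a n)
    (htrans : ∀ (a b : V) (n : ℤ),
      D (Y a b n) - Y a (D b) n = (n + 1) • Y a b (n + 1))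
    (hcomm : ∀ a b : V, ∃ N : ℕ, ∀ (c : V) (m n : ℤ),
      ∑ l ∈ Finset.range (N + 1), ((-1 : ℂ) ^ l * (N.choose l : ℂ)) •
        (Y a (Y b c (n - (l : ℤ))) (m - ((N - l : ℕ) : ℤ)) -
         Y b (Y a c (m - ((N - l : ℕ) : ℤ))) (n - (l : ℤ))) = 0)
    :
    ∀ (a b : V) (m n : ℤ), X1coeff D Y a b m n = X2coeff D Y b a n m := by
  have hDvac : D vac = 0 := by
    have h1 := hvacRight vac 1
    rw [hvacLeft] at h1
    simpa [expCoeff] using h1.symm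
  have hY0 : ∀ (a : V) (n : ℤ), Y a 0 n = 0 := by
    intro a n
    have h := htrans a vac n
    rw [hvacRight, hvacRight, hDvac, D_expCoeff] at h
    simpa using h
  -- `G a b` is the (not a priori linear) series `Y(a,z1) e^{z2 D} b`
  set G : V → V → ℤ → ℤ → V := fun a b m n => Y a (expCoeff D b n) m with hG
  have hGneg : ∀ a b m n, n < 0 → G a b m n = 0 := by
    intro a b m n hn
    simp only [hG]
    rw [expCoeff_neg D b n hn, hY0]
  have hloc : ∀ a b, ∃ N : ℕ, (del ^ N) (fun m n => G a b m n - G b a n m) = 0 := by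
    intro a b
    obtain ⟨N, hN⟩ := hcomm a b
    refine ⟨N, ?_⟩
    funext m n
    rw [del_pow_apply]
    have := hN vac m n
    simp only [hvacRight] at this
    exact this
  have hGD : ∀ a b, G a (D b) = dd D (G a b) := by
    intro a b
    funext m n
    simp only [hG, dd]
    rw [expCoeff_D, ← htrans]
    abel
  -- exact translation rule in the first argument
  have hE : ∀ a b m n, G (D b) a n m = D (G b a n m) - (m + 1) • G b a n (m + 1) := by
    intro a b
    obtain ⟨N1, h1⟩ := hloc a b
    obtain ⟨N2, h2⟩ := hloc a (D b)
    have h1' := del_pow_mono (le_max_left (N1 + 1) N2) (dd_kill D N1 _ h1)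
    have h2' := del_pow_mono (le_max_right (N1 + 1) N2) h2
    have h3 : (del ^ (max (N1 + 1) N2))
        (fun m n => G (D b) a n m - (D (G b a n m) - (m + 1) • G b a n (m + 1))) = 0 := by
      have e : (fun m n => G (D b) a n m - (D (G b a n m) - (m + 1) • G b a n (m + 1))) =
          dd D (fun m n => G a b m n - G b a n m) - (fun m n => G a (D b) m n - G (D b) a n m) := by
        rw [hGD]
        funext m n
        simp only [dd, Pi.sub_apply, map_sub, smul_sub]
        abel
      rw [e, map_sub, h1', h2', sub_zero]
    have h4 := kill_left _ _ (by
      intro m n hm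
      rw [hGneg _ _ _ _ hm, hGneg _ _ _ _ hm]
      by_cases hm' : m = -1
      · subst hm'; simp
      · rw [hGneg _ _ _ _ (by omega)]; simp) h3
    intro m n
    exact sub_eq_zero.mp (congrFun (congrFun h4 m) n)
  have hLeib : ∀ a b n, Y (D b) a n = (n + 1) • Y b a (n + 1) := by
    intro a b n
    have h := hE a b 0 n
    have e1 : expCoeff D a (0 + 1) = D a := by simp [expCoeff]
    simp only [hG] at h
    rw [expCoeff_zero, e1] at h
    rw [h, ← htrans]
    simp
  have hrec : ∀ a b m n, (n + 1) • G a b m (n + 1) =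
      D (G a b m n) - (m + 1) • G a b (m + 1) n := by
    intro a b m n
    have h := hE b a n m
    have h' : G (D a) b m n = (m + 1) • G a b (m + 1) n := hLeib _ _ _
    rw [← h', h]
    abel
  have hX1 : ∀ a b m n, G a b m n = X1coeff D Y a b m n := by
    intro a b m n
    by_cases hn : 0 ≤ n
    · obtain ⟨k, rfl⟩ := Int.eq_ofNat_of_zero_le hn
      clear hn
      induction k generalizing m with
      | zero =>
        simp only [hG]
        rw [X1_nat]
        simp [expCoeff_zero, intChoose_zero]
      | succ k ih =>
        have h1 := hrec a b m k
        rw [ih, ih, ← X1_rec, ← Int.cast_smul_eq_zsmul ℂ] at h1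
        push_cast at h1 ⊢
        exact smul_right_injective V (show (k : ℂ) + 1 ≠ 0 by exact_mod_cast k.succ_ne_zero) h1
    · rw [hGneg _ _ _ _ (by omega)]
      unfold X1coeff
      rw [if_neg hn]
  intro a b
  obtain ⟨N, hN⟩ := hloc a b
  have hK := X1_X2_kill D Y a b (Nf b a) (hfield b a)
  have h3 : (del ^ (max N (Nf b a)))
      (fun m n => X1coeff D Y a b m n - X2coeff D Y b a n m) = 0 := by
    have e : (fun m n => X1coeff D Y a b m n - X2coeff D Y b a n m) =
        (fun m n => G a b m n - G b a n m) +
        (fun m n => X1coeff D Y b a n m - X2coeff D Y b a n m) := by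
      funext m n
      simp only [Pi.add_apply, hX1]
      abel
    rw [e, map_add, del_pow_mono (le_max_left _ _) hN, del_pow_mono (le_max_right _ _) hK, add_zero]
  have h4 := kill_right _ _ (by
    intro m n hn
    unfold X1coeff X2coeff
    rw [if_neg (by omega), if_neg (by omega), sub_zero]) h3
  intro m n
  exact sub_eq_zero.mp (congrFun (congrFun h4 m) n)

end
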